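/- arXiv:2205.09197 — 4 statements merged into one kernel-verified Lean document; each statement's English description precedes it below -/
import Mathlib

section
/- Let H be a real Hilbert space and let a ∈ H with a ≠ 0. Suppose u₁, u₂ : [0, ∞) → H are two paths, continuous with respect to the weak topology of H, taking values in the closed ball {v ∈ H : ‖v‖ ≤ ‖a‖}, such that u₁(t) = a for all t ≥ 0 and u₂(t₀) ≠ a for some t₀ ≥ 0. Then there exist a function φ : H → ℝ that is continuous with respect to the weak topology of H and a real number λ > 0 such that ∫₀^∞ e^{-λt} φ(u₁(t)) dt > ∫₀^∞ e^{-λt} φ(u₂(t)) dt. -/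
open MeasureTheory Set

/-- The equality case of Cauchy–Schwarz on the ball of radius `‖a‖`. -/
theorem eq_of_norm_le_of_norm_sq_le_inner {H : Type*} [NormedAddCommGroup H]
    [InnerProductSpace ℝ H] {a v : H} (hv : ‖v‖ ≤ ‖a‖) (h : ‖a‖ ^ 2 ≤ inner ℝ a v) : v = a := by
  have h₁ := norm_sub_sq_real v a
  rw [real_inner_comm] at h₁
  have h₂ : ‖v‖ ^ 2 ≤ ‖a‖ ^ 2 := by gcongr
  have h₃ : ‖v - a‖ ^ 2 = 0 := le_antisymm (by linarith) (sq_nonneg _)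
  exact sub_eq_zero.mp (norm_eq_zero.mp (pow_eq_zero_iff two_ne_zero |>.mp h₃))

/-- Two continuous integrable functions on `[0, ∞)` with `f ≤ g` that differ somewhere have
different integrals. -/
theorem setIntegral_Ioi_lt_of_continuousOn_of_le {f g : ℝ → ℝ}
    (hf : ContinuousOn f (Ici 0)) (hg : ContinuousOn g (Ici 0))
    (hfi : IntegrableOn f (Ioi 0)) (hgi : IntegrableOn g (Ioi 0))
    (hle : ∀ t ≥ (0 : ℝ), f t ≤ g t) (hne : ∃ t ≥ (0 : ℝ), f t ≠ g t) :
    ∫ t in Ioi (0 : ℝ), f t < ∫ t in Ioi (0 : ℝ), g t := by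
  rw [← integrableOn_Ici_iff_integrableOn_Ioi] at hfi hgi
  simp only [← integral_Ici_eq_integral_Ioi]
  have hae : f ≤ᵐ[volume.restrict (Ici 0)] g :=
    (ae_restrict_iff' measurableSet_Ici).mpr (.of_forall hle)
  refine lt_of_le_of_ne (integral_mono_ae hfi hgi hae) fun heq => ?_
  obtain ⟨t, ht, hne⟩ := hne
  refine hne (Measure.eqOn_of_ae_eq ((integral_eq_iff_of_ae_le hfi hgi hae).mp heq) hf hg ?_ ht)
  simp

/-- Separation of a constant weakly continuous path from a non-constant one by a
Laplace-type functional `I_{λ,φ}[u] = ∫₀^∞ e^{-λt} φ(u(t)) dt`, where `φ` is continuous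
for the weak topology of the real Hilbert space `H`. -/
theorem exists_weakly_continuous_separating_functional
    {H : Type*} [NormedAddCommGroup H] [InnerProductSpace ℝ H] [CompleteSpace H]
    (a : H) (ha : a ≠ 0) (u₁ u₂ : ℝ → H)
    (hc₁ : ContinuousOn (fun t => toWeakSpace ℝ H (u₁ t)) (Ici 0))
    (hc₂ : ContinuousOn (fun t => toWeakSpace ℝ H (u₂ t)) (Ici 0))
    (hb₁ : ∀ t ≥ (0 : ℝ), ‖u₁ t‖ ≤ ‖a‖)
    (hb₂ : ∀ t ≥ (0 : ℝ), ‖u₂ t‖ ≤ ‖a‖)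
    (hu₁ : ∀ t ≥ (0 : ℝ), u₁ t = a)
    (hu₂ : ∃ t₀ ≥ (0 : ℝ), u₂ t₀ ≠ a) :
    ∃ φ : H → ℝ,
      Continuous (fun v : WeakSpace ℝ H => φ ((toWeakSpace ℝ H).symm v)) ∧
      ∃ l : ℝ, 0 < l ∧
        (∫ t in Ioi (0 : ℝ), Real.exp (-l * t) * φ (u₂ t))
          < ∫ t in Ioi (0 : ℝ), Real.exp (-l * t) * φ (u₁ t) := by
  obtain ⟨t₀, ht₀, hne⟩ := hu₂
  have hφ : Continuous (fun v : WeakSpace ℝ H => inner ℝ a ((toWeakSpace ℝ H).symm v)) :=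
    WeakBilin.eval_continuous (topDualPairing ℝ H).flip (innerSL ℝ a)
  have hexp : Continuous fun t : ℝ => Real.exp (-1 * t) := by fun_prop
  have hcont : ∀ u : ℝ → H, ContinuousOn (fun t => toWeakSpace ℝ H (u t)) (Ici 0) →
      ContinuousOn (fun t => Real.exp (-1 * t) * inner ℝ a (u t)) (Ici 0) := fun u hu =>
    hexp.continuousOn.mul (hφ.comp_continuousOn hu)
  have hint : ∀ u : ℝ → H, ContinuousOn (fun t => toWeakSpace ℝ H (u t)) (Ici 0) →
      (∀ t ≥ (0 : ℝ), ‖u t‖ ≤ ‖a‖) →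
      IntegrableOn (fun t => Real.exp (-1 * t) * inner ℝ a (u t)) (Ioi 0) := by
    intro u hu hb
    refine ((exp_neg_integrableOn_Ioi 0 one_pos).mul_const (‖a‖ * ‖a‖)).mono'
      (((hcont u hu).mono Ioi_subset_Ici_self).aestronglyMeasurable measurableSet_Ioi) ?_
    refine (ae_restrict_iff' measurableSet_Ioi).mpr (.of_forall fun t ht => ?_)
    rw [norm_mul, Real.norm_of_nonneg (Real.exp_nonneg _)]
    gcongr
    exact (norm_inner_le_norm a (u t)).trans (by gcongr; exact hb t (le_of_lt ht))
  refine ⟨inner ℝ a, hφ, 1, one_pos,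
    setIntegral_Ioi_lt_of_continuousOn_of_le (hcont u₂ hc₂) (hcont u₁ hc₁)
      (hint u₂ hc₂ hb₂) (hint u₁ hc₁ hb₁) (fun t ht => ?_) ⟨t₀, ht₀, fun heq => hne ?_⟩⟩
  · rw [hu₁ t ht, real_inner_self_eq_norm_mul_norm]
    gcongr
    exact (real_inner_le_norm a (u₂ t)).trans (by gcongr; exact hb₂ t ht)
  · rw [hu₁ t₀ ht₀] at heq
    refine eq_of_norm_le_of_norm_sq_le_inner (hb₂ t₀ ht₀) ?_
    rw [mul_left_cancel₀ (Real.exp_pos _).ne' heq, real_inner_self_eq_norm_sq]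
end

section
/- Let H be a Polish space (a separable completely metrizable topological space) equipped with its Borel σ-algebra, and let Ω = C([0, ∞); H) be the space of continuous paths in H with the compact-open topology and its Borel σ-algebra. Let S : H → Set(Ω) be a set-valued map such that: (i) for every a ∈ H, S(a) is a nonempty compact subset of Ω; (ii) S is Borel measurable as a map into the nonempty compact subsets of Ω (equivalently, {a : S(a) ∩ U ≠ ∅} is Borel for every open U ⊆ Ω); (iii) every u ∈ S(a) satisfies u(0) = a; (iv) (shift invariance) for every a ∈ H, u ∈ S(a), and t ≥ 0, the shifted path s ↦ u(t + s) belongs to S(u(t)); (v) (concatenation) for every a ∈ H, u ∈ S(a), t ≥ 0, and v ∈ S(u(t)), the path w defined by w(s) = u(s) for s ≤ t and w(s) = v(s − t) for s > t belongs to S(a). Then there exists a Borel measurable map U : H → Ω such that U(a) ∈ S(a) for every a ∈ H, and U satisfies the semigroup property: U(a)(t + s) = U(U(a)(t))(s) for all a ∈ H and all s, t ≥ 0. -/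
open scoped NNReal

namespace SemiflowSelection

open Set MeasureTheory Filter Topology

/-- The Laplace transform, at the point `c`, of the observable `φ` along the path `u`. -/
noncomputable def laplaceFunctional {H : Type*} [TopologicalSpace H] (c : ℝ) (φ : C(H, ℝ))
    (u : C(ℝ≥0, H)) : ℝ :=
  ∫ t in Ioi (0 : ℝ), Real.exp (-c * t) * φ (u t.toNNReal)

/-- The minimizers of `ζ` in each value of the correspondence `S`. -/
def minimizers {H Ω : Type*} (ζ : Ω → ℝ) (S : H → Set Ω) (a : H) : Set Ω :=
  {u | u ∈ S a ∧ ∀ v ∈ S a, ζ u ≤ ζ v}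

/-- Successive minimization of a sequence of functionals. -/
def iterMinimizers {H Ω : Type*} (ζ : ℕ → Ω → ℝ) (S : H → Set Ω) : ℕ → H → Set Ω
  | 0 => S
  | n + 1 => minimizers (ζ n) (iterMinimizers ζ S n)

/-- The path `u` restarted at time `t`. -/
def shiftPath {H : Type*} [TopologicalSpace H] (t : ℝ≥0) (u : C(ℝ≥0, H)) : C(ℝ≥0, H) :=
  ⟨fun s => u (t + s), by fun_prop⟩

@[simp]
theorem shiftPath_apply {H : Type*} [TopologicalSpace H] (t : ℝ≥0) (u : C(ℝ≥0, H)) (s : ℝ≥0) :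
    shiftPath t u s = u (t + s) := rfl

theorem exists_concatPath {H : Type*} [TopologicalSpace H] (t : ℝ≥0) (u v : C(ℝ≥0, H))
    (h : v 0 = u t) :
    ∃ w : C(ℝ≥0, H), (∀ s ≤ t, w s = u s) ∧ shiftPath t w = v := by
  classical
  refine ⟨⟨fun s => if s ≤ t then u s else v (s - t), ?_⟩, ?_, ?_⟩
  · refine Continuous.if_le (by fun_prop) (by fun_prop) continuous_id continuous_const ?_
    rintro s rfl
    simp [h]
  · intro s hs
    simp [hs]
  · ext s
    rcases eq_or_ne s 0 with rfl | hs
    · simp [h]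
    · simp [hs]

/-- A set-valued map into the path space with nonempty compact values, Borel measurable, whose
values are stable under shifts and concatenations. -/
structure IsPathCorrespondence {H : Type*} [TopologicalSpace H] [MeasurableSpace H]
    (S : H → Set C(ℝ≥0, H)) : Prop where
  nonempty (a : H) : (S a).Nonempty
  isCompact (a : H) : IsCompact (S a)
  measurableSet_hits {C : Set C(ℝ≥0, H)} : IsClosed C → MeasurableSet {a | (S a ∩ C).Nonempty}
  apply_zero {a : H} {u : C(ℝ≥0, H)} : u ∈ S a → u 0 = a
  shift_mem {a : H} {u : C(ℝ≥0, H)} (t : ℝ≥0) : u ∈ S a → shiftPath t u ∈ S (u t)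
  concat_mem {a : H} {u w : C(ℝ≥0, H)} (t : ℝ≥0) : u ∈ S a → (∀ s ≤ t, w s = u s) →
    shiftPath t w ∈ S (u t) → w ∈ S a

section Laplace

variable {H : Type*} [TopologicalSpace H] {c : ℝ} {φ : C(H, ℝ)}

theorem integrableOn_laplaceFunctional (hc : 0 < c) (hφ : ∀ x, 0 ≤ φ x ∧ φ x ≤ 1)
    (u : C(ℝ≥0, H)) :
    IntegrableOn (fun t : ℝ => Real.exp (-c * t) * φ (u t.toNNReal)) (Ioi 0) := by
  refine (exp_neg_integrableOn_Ioi 0 hc).mono' (by fun_prop) (ae_of_all _ fun t => ?_)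
  rw [Real.norm_of_nonneg (mul_nonneg (Real.exp_pos _).le (hφ _).1)]
  exact mul_le_of_le_one_right (Real.exp_pos _).le (hφ _).2

theorem continuous_laplaceFunctional [TopologicalSpace.MetrizableSpace H] (hc : 0 < c)
    (hφ : ∀ x, 0 ≤ φ x ∧ φ x ≤ 1) : Continuous (laplaceFunctional c φ) := by
  refine continuous_of_dominated (bound := fun t => Real.exp (-c * t)) (fun u => by fun_prop)
    (fun u => ae_of_all _ fun t => ?_) (exp_neg_integrableOn_Ioi 0 hc)
    (ae_of_all _ fun t => by fun_prop)
  rw [Real.norm_of_nonneg (mul_nonneg (Real.exp_pos _).le (hφ _).1)]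
  exact mul_le_of_le_one_right (Real.exp_pos _).le (hφ _).2

theorem laplaceFunctional_eq_add_shift (hc : 0 < c) (hφ : ∀ x, 0 ≤ φ x ∧ φ x ≤ 1)
    (t : ℝ≥0) (u : C(ℝ≥0, H)) :
    laplaceFunctional c φ u =
      (∫ r in (0 : ℝ)..t, Real.exp (-c * r) * φ (u r.toNNReal)) +
        Real.exp (-c * t) * laplaceFunctional c φ (shiftPath t u) := by
  have hint := integrableOn_laplaceFunctional hc hφ u
  unfold laplaceFunctional
  rw [← intervalIntegral.integral_interval_add_Ioi hint
    (hint.mono_set (Ioi_subset_Ioi t.coe_nonneg))]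
  congr 1
  have hpre : (fun r : ℝ => r + t) ⁻¹' Ioi (t : ℝ) = Ioi 0 := by ext; simp
  rw [← (measurePreserving_add_right volume (t : ℝ)).setIntegral_preimage_emb
    (measurableEmbedding_addRight _), hpre, ← integral_const_mul]
  refine setIntegral_congr_fun measurableSet_Ioi fun r hr => ?_
  have hr' : 0 ≤ r := le_of_lt hr
  have : (r + t).toNNReal = t + r.toNNReal := by
    rw [Real.toNNReal_add hr' t.coe_nonneg, Real.toNNReal_coe, add_comm]
  simp only [this, shiftPath_apply, ← mul_assoc, ← Real.exp_add]
  ring_nf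

/-- If two paths agree up to time `t`, their Laplace functionals compare as those of the shifts. -/
theorem laplaceFunctional_le_iff_shift (hc : 0 < c) (hφ : ∀ x, 0 ≤ φ x ∧ φ x ≤ 1)
    (t : ℝ≥0) {u w : C(ℝ≥0, H)} (h : ∀ s ≤ t, w s = u s) :
    laplaceFunctional c φ u ≤ laplaceFunctional c φ w ↔
      laplaceFunctional c φ (shiftPath t u) ≤ laplaceFunctional c φ (shiftPath t w) := by
  have heq : (∫ r in (0 : ℝ)..t, Real.exp (-c * r) * φ (u r.toNNReal)) =
      ∫ r in (0 : ℝ)..t, Real.exp (-c * r) * φ (w r.toNNReal) := by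
    refine intervalIntegral.integral_congr fun r hr => ?_
    rw [uIcc_of_le t.coe_nonneg] at hr
    simp only [h _ (Real.toNNReal_le_iff_le_coe.2 hr.2)]
  rw [laplaceFunctional_eq_add_shift hc hφ t u, laplaceFunctional_eq_add_shift hc hφ t w, heq,
    add_le_add_iff_left, mul_le_mul_iff_right₀ (Real.exp_pos _)]

end Laplace

/-- A continuous `[0, 1]`-valued function on the half-line is determined by the values of its
Laplace transform at the positive integers. -/
theorem eq_of_laplace_eq {f g : C(ℝ≥0, ℝ)} (hf : ∀ x, 0 ≤ f x ∧ f x ≤ 1)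
    (hg : ∀ x, 0 ≤ g x ∧ g x ≤ 1)
    (h : ∀ n : ℕ, laplaceFunctional (n + 1) f (.id ℝ≥0) = laplaceFunctional (n + 1) g (.id ℝ≥0)) :
    f = g := by
  let ν : Measure ℝ≥0 := (volume.restrict (Ioi (0 : ℝ))).map Real.toNNReal
  let D (k : C(ℝ≥0, ℝ)) (x : ℝ≥0) : ENNReal := ENNReal.ofReal (Real.exp (-x) * k x)
  have hDmeas (k) : Measurable (D k) := by dsimp only [D]; fun_prop
  have hDfin (k : C(ℝ≥0, ℝ)) (hk : ∀ x, 0 ≤ k x ∧ k x ≤ 1) : ∫⁻ x, D k x ∂ν ≠ ⊤ := by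
    rw [lintegral_map (hDmeas k) measurable_real_toNNReal]
    have hi := (integrableOn_laplaceFunctional one_pos hk (.id ℝ≥0)).lintegral_lt_top
    refine (lt_of_le_of_lt (le_of_eq ?_) hi).ne
    refine setLIntegral_congr_fun measurableSet_Ioi fun t ht => ?_
    simp [D, Real.coe_toNNReal t (le_of_lt ht)]
  let e : BoundedContinuousFunction ℝ≥0 ℝ :=
    .ofNormedAddCommGroup (fun x : ℝ≥0 => Real.exp (-x)) (by fun_prop) 1 (fun x => by simp)
  let A : StarSubalgebra ℝ (BoundedContinuousFunction ℝ≥0 ℝ) :=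
    { (Polynomial.aeval (R := ℝ) e).range with
      star_mem' := fun {a} ha => by rwa [show star a = a from rfl] }
  have hpow (k : C(ℝ≥0, ℝ)) (hk : ∀ x, 0 ≤ k x ∧ k x ≤ 1) (n : ℕ) :
      ∫ x, (e ^ n) x ∂(ν.withDensity (D k)) = laplaceFunctional (n + 1) k (.id ℝ≥0) := by
    rw [integral_withDensity_eq_integral_toReal_smul (hDmeas k)
      (ae_of_all _ fun x => ENNReal.ofReal_lt_top), integral_map (by fun_prop) ?_]
    · refine setIntegral_congr_fun measurableSet_Ioi fun t ht => ?_
      have ht' : 0 ≤ t := le_of_lt ht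
      simp only [D, e, ENNReal.toReal_ofReal (mul_nonneg (Real.exp_pos _).le (hk _).1),
        BoundedContinuousFunction.coe_pow, Pi.pow_apply,
        BoundedContinuousFunction.coe_ofNormedAddCommGroup, Real.coe_toNNReal t ht',
        smul_eq_mul, ← Real.exp_nat_mul, ContinuousMap.id_apply]
      rw [mul_right_comm, ← Real.exp_add]
      ring_nf
    · exact ((hDmeas k).ennreal_toReal.smul (e ^ n).continuous.measurable).aestronglyMeasurable
  have hFf : IsFiniteMeasure (ν.withDensity (D f)) := isFiniteMeasure_withDensity (hDfin f hf)
  have hFg : IsFiniteMeasure (ν.withDensity (D g)) := isFiniteMeasure_withDensity (hDfin g hg)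
  have hmeq : ν.withDensity (D f) = ν.withDensity (D g) := by
    refine ext_of_forall_mem_subalgebra_integral_eq_of_polish (𝕜 := ℝ) (A := A) ?_ ?_
    · intro x y hxy
      refine ⟨e, ⟨e.toContinuousMap, ⟨e, ⟨Polynomial.X, by simp⟩, rfl⟩, rfl⟩, ?_⟩
      simpa [e] using hxy
    · rintro _ ⟨p, rfl⟩
      induction p using Polynomial.induction_on' with
      | add p q hp hq =>
        simp only [map_add, BoundedContinuousFunction.coe_add, Pi.add_apply]
        rw [integral_add (BoundedContinuousFunction.integrable _ _)
          (BoundedContinuousFunction.integrable _ _),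
          integral_add (BoundedContinuousFunction.integrable _ _)
          (BoundedContinuousFunction.integrable _ _)]
        exact congrArg₂ _ hp hq
      | monomial n b =>
        have hm : (Polynomial.aeval e) (Polynomial.monomial n b) = b • e ^ n := by
          rw [Polynomial.aeval_monomial, ← Algebra.smul_def]
        have hi (μ : Measure ℝ≥0) :
            ∫ x, ((Polynomial.aeval e) (Polynomial.monomial n b)) x ∂μ =
              b * ∫ x, (e ^ n) x ∂μ := by
          rw [hm, ← integral_const_mul]
          rfl
        exact (hi _).trans (((congrArg _ ((hpow f hf n).trans
          ((h n).trans (hpow g hg n).symm))).trans (hi _).symm))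
  rw [withDensity_eq_iff (hDmeas f).aemeasurable (hDmeas g).aemeasurable (hDfin f hf)] at hmeq
  have hae : (fun t : ℝ => f t.toNNReal) =ᵐ[volume.restrict (Ioi 0)] fun t => g t.toNNReal := by
    filter_upwards [ae_of_ae_map measurable_real_toNNReal.aemeasurable hmeq] with t ht
    have := (ENNReal.ofReal_eq_ofReal_iff (mul_nonneg (Real.exp_pos _).le (hf _).1)
      (mul_nonneg (Real.exp_pos _).le (hg _).1)).1 ht
    exact mul_left_cancel₀ (Real.exp_pos _).ne' this
  rw [Measure.restrict_congr_set Ioi_ae_eq_Ici] at hae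
  have heq := Measure.eqOn_of_ae_eq hae (by fun_prop) (by fun_prop) (by simp)
  ext x
  simpa using heq x.coe_nonneg

theorem exists_seq_continuousMap_separating (H : Type*) [TopologicalSpace H] [PolishSpace H] :
    ∃ φ : ℕ → C(H, ℝ), (∀ n x, 0 ≤ φ n x ∧ φ n x ≤ 1) ∧
      ∀ x y, (∀ n, φ n x = φ n y) → x = y := by
  rcases isEmpty_or_nonempty H with hH | hH
  · exact ⟨fun _ => 0, fun _ x => hH.elim x, fun x => hH.elim x⟩
  let := TopologicalSpace.upgradeIsCompletelyMetrizable H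
  refine ⟨fun n => ⟨fun x => Real.exp (-dist x (TopologicalSpace.denseSeq H n)), by fun_prop⟩,
    fun n x => ⟨(Real.exp_pos _).le, by simp⟩, fun x y h => ?_⟩
  have h1 : (fun z => dist x z) = fun z => dist y z := by
    refine Continuous.ext_on (TopologicalSpace.denseRange_denseSeq H) (by fun_prop)
      (by fun_prop) ?_
    rintro _ ⟨n, rfl⟩
    simpa using h n
  simpa using congrFun h1 y

section Minimizers

variable {H : Type*} [TopologicalSpace H] [MeasurableSpace H] {S : H → Set C(ℝ≥0, H)}

theorem IsPathCorrespondence.minimizers [TopologicalSpace.MetrizableSpace H]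
    (hS : IsPathCorrespondence S) {c : ℝ} (hc : 0 < c) {φ : C(H, ℝ)}
    (hφ : ∀ x, 0 ≤ φ x ∧ φ x ≤ 1) :
    IsPathCorrespondence (minimizers (laplaceFunctional c φ) S) := by
  have hζ := continuous_laplaceFunctional hc hφ
  refine ⟨fun a => ?_, fun a => ?_, fun {C} hC => ?_, fun hu => hS.apply_zero hu.1, ?_, ?_⟩
  · obtain ⟨u, hu, hmin⟩ := (hS.isCompact a).exists_isMinOn (hS.nonempty a) hζ.continuousOn
    exact ⟨u, hu, hmin⟩
  · have : SemiflowSelection.minimizers (laplaceFunctional c φ) S a =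
        S a ∩ ⋂ v ∈ S a, {u | laplaceFunctional c φ u ≤ laplaceFunctional c φ v} := by
      ext u
      simp [SemiflowSelection.minimizers]
    rw [this]
    exact (hS.isCompact a).inter_right
      (isClosed_biInter fun v _ => isClosed_le hζ continuous_const)
  · have hsub (q : ℚ) : IsClosed {u | laplaceFunctional c φ u ≤ q} :=
      isClosed_le hζ continuous_const
    have : {a | (SemiflowSelection.minimizers (laplaceFunctional c φ) S a ∩ C).Nonempty} =
        {a | (S a ∩ C).Nonempty} ∩
        ⋂ q : ℚ, {a | (S a ∩ {u | laplaceFunctional c φ u ≤ q}).Nonempty}ᶜ ∪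
          {a | (S a ∩ (C ∩ {u | laplaceFunctional c φ u ≤ q})).Nonempty} := by
      ext a
      simp only [mem_inter_iff, mem_iInter, mem_union, mem_compl_iff, mem_ofPred_eq]
      constructor
      · rintro ⟨u, ⟨huS, hmin⟩, huC⟩
        refine ⟨⟨u, huS, huC⟩, fun q => or_iff_not_imp_left.2 fun hq => ?_⟩
        obtain ⟨v, hvS, hv⟩ := not_not.1 hq
        exact ⟨u, huS, huC, (hmin v hvS).trans hv⟩
      · rintro ⟨hne, hq⟩
        obtain ⟨u, ⟨huS, huC⟩, hmin⟩ :=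
          ((hS.isCompact a).inter_right hC).exists_isMinOn hne hζ.continuousOn
        refine ⟨u, ⟨huS, fun v hv => ?_⟩, huC⟩
        by_contra! hlt
        obtain ⟨q, hvq, hqu⟩ := exists_rat_btwn hlt
        obtain ⟨w, hwS, hwC, hw⟩ := (hq q).resolve_left (not_not.2 ⟨v, hv, hvq.le⟩)
        exact absurd (hmin ⟨hwS, hwC⟩) (not_le.2 (lt_of_le_of_lt hw hqu))
    rw [this]
    exact (hS.measurableSet_hits hC).inter (MeasurableSet.iInter fun q =>
      (hS.measurableSet_hits (hsub q)).compl.union (hS.measurableSet_hits (hC.inter (hsub q))))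
  · rintro a u t ⟨hu, hmin⟩
    refine ⟨hS.shift_mem t hu, fun v hv => ?_⟩
    obtain ⟨w, hwu, rfl⟩ := exists_concatPath t u v (hS.apply_zero hv)
    exact (laplaceFunctional_le_iff_shift hc hφ t hwu).1 (hmin w (hS.concat_mem t hu hwu hv))
  · rintro a u w t ⟨hu, hmin⟩ hwu ⟨hw, hwmin⟩
    refine ⟨hS.concat_mem t hu hwu hw, fun v hv => le_trans ?_ (hmin v hv)⟩
    exact (laplaceFunctional_le_iff_shift hc hφ t fun s hs => (hwu s hs).symm).2
      (hwmin _ (hS.shift_mem t hu))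

end Minimizers

theorem antitone_iterMinimizers {H Ω : Type*} (ζ : ℕ → Ω → ℝ) (S : H → Set Ω) (a : H) :
    Antitone fun n => iterMinimizers ζ S n a :=
  antitone_nat_of_succ_le fun _ _ hu => hu.1

/-- For compact-valued maps into a metrizable space, measurability of the hitting sets of open sets
gives measurability of the hitting sets of closed sets. -/
theorem measurableSet_hits_of_isClosed {H Ω : Type*} [MeasurableSpace H] [TopologicalSpace Ω]
    [TopologicalSpace.MetrizableSpace Ω] {S : H → Set Ω} (hcpt : ∀ a, IsCompact (S a))
    (hmeas : ∀ U : Set Ω, IsOpen U → MeasurableSet {a | (S a ∩ U).Nonempty})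
    {C : Set Ω} (hC : IsClosed C) : MeasurableSet {a | (S a ∩ C).Nonempty} := by
  let := TopologicalSpace.metrizableSpaceMetric Ω
  let δ (n : ℕ) : ℝ := 1 / (n + 1)
  have hδ (n) : 0 < δ n := Nat.one_div_pos_of_nat
  have : {a | (S a ∩ C).Nonempty} = ⋂ n, {a | (S a ∩ Metric.thickening (δ n) C).Nonempty} := by
    ext a
    simp only [mem_iInter, mem_ofPred_eq]
    constructor
    · rintro ⟨u, huS, huC⟩ n
      exact ⟨u, huS, Metric.self_subset_thickening (hδ n) C huC⟩
    · intro h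
      by_contra hne
      have hdisj : Disjoint (S a) C := by
        rwa [disjoint_iff_inter_eq_empty, ← not_nonempty_iff_eq_empty]
      obtain ⟨r, hr, hd⟩ := hdisj.exists_thickenings (hcpt a) hC
      obtain ⟨n, hn⟩ := exists_nat_one_div_lt hr
      obtain ⟨u, huS, huC⟩ := h n
      exact disjoint_left.1 hd (Metric.self_subset_thickening hr _ huS)
        (Metric.thickening_mono hn.le C huC)
  rw [this]
  exact MeasurableSet.iInter fun n => hmeas _ Metric.isOpen_thickening

end SemiflowSelection

open SemiflowSelection Set

/-- The measurable semigroup (semiflow) selection theorem of Cardona and Kapitanski: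
a Borel measurable set-valued map `S` on a Polish space `H`, with nonempty compact values
in the path space `Ω = C([0,∞); H)` (compact-open topology), whose values start at the
base point and are stable under time shifts and concatenations, admits a Borel measurable
selection `U` satisfying the semigroup property. -/
theorem measurable_semiflow_selection
    {H : Type*} [TopologicalSpace H] [PolishSpace H]
    [MeasurableSpace H] [BorelSpace H]
    [MeasurableSpace C(ℝ≥0, H)] [BorelSpace C(ℝ≥0, H)]
    (S : H → Set C(ℝ≥0, H))
    (hne : ∀ a : H, (S a).Nonempty)
    (hcpt : ∀ a : H, IsCompact (S a))
    (hmeas : ∀ U : Set C(ℝ≥0, H), IsOpen U → MeasurableSet {a : H | (S a ∩ U).Nonempty})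
    (hstart : ∀ a : H, ∀ u ∈ S a, u 0 = a)
    (hshift : ∀ a : H, ∀ u ∈ S a, ∀ t : ℝ≥0, ∀ w : C(ℝ≥0, H),
      (∀ s : ℝ≥0, w s = u (t + s)) → w ∈ S (u t))
    (hconcat : ∀ a : H, ∀ u ∈ S a, ∀ t : ℝ≥0, ∀ v ∈ S (u t), ∀ w : C(ℝ≥0, H),
      (∀ s : ℝ≥0, s ≤ t → w s = u s) → (∀ s : ℝ≥0, t < s → w s = v (s - t)) →
      w ∈ S a) :
    ∃ U : H → C(ℝ≥0, H), Measurable U ∧ (∀ a : H, U a ∈ S a) ∧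
      ∀ (a : H) (t s : ℝ≥0), U a (t + s) = U (U a t) s := by
  have h₀ : IsPathCorrespondence S :=
    { nonempty := hne
      isCompact := hcpt
      measurableSet_hits := measurableSet_hits_of_isClosed hcpt hmeas
      apply_zero := fun hu => hstart _ _ hu
      shift_mem := fun t hu => hshift _ _ hu t _ fun _ => rfl
      concat_mem := fun {a u w} t hu hwu hw => hconcat a u hu t _ hw w hwu fun s hs => by
        rw [shiftPath_apply, add_tsub_cancel_of_le hs.le] }
  obtain ⟨φ, hφ, hsep⟩ := exists_seq_continuousMap_separating H
  let ζ (k : ℕ) : C(ℝ≥0, H) → ℝ := laplaceFunctional (k.unpair.1 + 1) (φ k.unpair.2)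
  have hiter (n : ℕ) : IsPathCorrespondence (iterMinimizers ζ S n) := by
    induction n with
    | zero => exact h₀
    | succ n ih => exact ih.minimizers (by positivity) (hφ _)
  have hanti (a : H) := antitone_iterMinimizers ζ S a
  have hinter (a : H) (C : Set C(ℝ≥0, H)) (hC : IsClosed C)
      (h : ∀ n, (iterMinimizers ζ S n a ∩ C).Nonempty) :
      ((⋂ n, iterMinimizers ζ S n a) ∩ C).Nonempty := by
    rw [iInter_inter]
    exact IsCompact.nonempty_iInter_of_sequence_nonempty_isCompact_isClosed _
      (fun n => inter_subset_inter_left _ (hanti a n.le_succ)) h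
      (((hiter 0).isCompact a).inter_right hC)
      fun n => ((hiter n).isCompact a).isClosed.inter hC
  have huniq (a : H) {u v : C(ℝ≥0, H)} (hu : ∀ n, u ∈ iterMinimizers ζ S n a)
      (hv : ∀ n, v ∈ iterMinimizers ζ S n a) : u = v := by
    ext t
    refine hsep _ _ fun m => ?_
    have : (φ m).comp u = (φ m).comp v := by
      refine eq_of_laplace_eq (fun _ => hφ m _) (fun _ => hφ m _) fun n => ?_
      have h := le_antisymm ((hu (Nat.pair n m + 1)).2 v (hv _))
        ((hv (Nat.pair n m + 1)).2 u (hu _))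
      simp only [ζ, Nat.unpair_pair] at h
      exact h
    exact DFunLike.congr_fun this t
  have hex (a : H) : ∃ u, ∀ n, u ∈ iterMinimizers ζ S n a := by
    obtain ⟨u, hu, -⟩ := hinter a univ isClosed_univ
      fun n => by simpa using (hiter n).nonempty a
    exact ⟨u, mem_iInter.1 hu⟩
  choose U hU using hex
  refine ⟨U, measurable_of_isClosed fun C hC => ?_, fun a => hU a 0, fun a t s => ?_⟩
  · have : U ⁻¹' C = ⋂ n, {a | (iterMinimizers ζ S n a ∩ C).Nonempty} := by
      ext a
      simp only [mem_preimage, mem_iInter, mem_ofPred_eq]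
      refine ⟨fun h n => ⟨U a, hU a n, h⟩, fun h => ?_⟩
      obtain ⟨u, hu, huC⟩ := hinter a C hC h
      rwa [huniq a (hU a) (mem_iInter.1 hu)]
    rw [this]
    exact MeasurableSet.iInter fun n => (hiter n).measurableSet_hits hC
  · exact DFunLike.congr_fun
      (huniq (U a t) (fun n => (hiter n).shift_mem t (hU a n)) (hU (U a t))) s
end

section
/- Let H be a Polish space with its Borel σ-algebra and let Ω be a Polish space. Let S : H → Set(Ω) be a set-valued map taking nonempty compact values that is Borel measurable (i.e., {a : S(a) ∩ U ≠ ∅} is Borel for every open U ⊆ Ω), and let I : Ω → ℝ be a continuous function. Define the refined set-valued map S^I(a) = {u ∈ S(a) : I(u) = max{I(v) : v ∈ S(a)}}. Then S^I takes nonempty compact values and is Borel measurable. -/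
/-- For a compact-valued map into a metrizable space, measurability of the hitting sets of open
sets implies measurability of the hitting sets of closed sets. -/
theorem measurableSet_inter_nonempty_of_isClosed {H Ω : Type*} [MeasurableSpace H]
    [TopologicalSpace Ω] [TopologicalSpace.MetrizableSpace Ω] {S : H → Set Ω}
    (hcpt : ∀ a, IsCompact (S a))
    (hmeas : ∀ U : Set Ω, IsOpen U → MeasurableSet {a | (S a ∩ U).Nonempty})
    {C : Set Ω} (hC : IsClosed C) : MeasurableSet {a | (S a ∩ C).Nonempty} := by
  let _ := TopologicalSpace.metrizableSpaceMetric Ω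
  have key : {a | (S a ∩ C).Nonempty} =
      ⋂ n : ℕ, {a | (S a ∩ Metric.thickening (1 / ((n : ℝ) + 1)) C).Nonempty} := by
    ext a
    simp only [Set.mem_iInter, Set.mem_ofPred_eq]
    refine ⟨fun h n => h.mono (Set.inter_subset_inter_right _
      (Metric.self_subset_thickening Nat.one_div_pos_of_nat C)), fun h => ?_⟩
    by_contra hne
    obtain ⟨δ, hδ, hd⟩ := (Set.disjoint_iff_inter_eq_empty.2
      (Set.not_nonempty_iff_eq_empty.1 hne)).exists_thickenings (hcpt a) hC
    obtain ⟨n, hn⟩ := exists_nat_one_div_lt hδ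
    obtain ⟨x, hxS, hxC⟩ := h n
    exact Set.disjoint_left.1 hd (Metric.self_subset_thickening hδ _ hxS)
      (Metric.thickening_mono hn.le _ hxC)
  rw [key]
  exact MeasurableSet.iInter fun n => hmeas _ Metric.isOpen_thickening

/-- A closed set `F` contains a maximizer of a continuous function `f` on a compact set `K` iff
for every rational `q` such that `f` exceeds `q` somewhere on `K`, `f` is at least `q` somewhere on
`K ∩ F`. -/
theorem IsCompact.exists_isMaxOn_mem_iff_forall_rat {Ω : Type*} [TopologicalSpace Ω] {K F : Set Ω}
    (hK : IsCompact K) (hne : K.Nonempty) (hF : IsClosed F) {f : Ω → ℝ} (hf : Continuous f) :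
    (∃ u ∈ K ∩ F, f u = sSup (f '' K)) ↔
      ∀ q : ℚ, (K ∩ {x | (q : ℝ) < f x}).Nonempty → (K ∩ (F ∩ {x | (q : ℝ) ≤ f x})).Nonempty := by
  have hbdd : BddAbove (f '' K) := (hK.image hf).bddAbove
  constructor
  · rintro ⟨u, ⟨huK, huF⟩, hu⟩ q ⟨x, hxK, hx⟩
    exact ⟨u, huK, huF, hx.le.trans (hu ▸ le_csSup hbdd (Set.mem_image_of_mem f hxK))⟩
  · intro h
    obtain ⟨v, hvK, hv⟩ := hK.exists_sSup_image_eq hne hf.continuousOn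
    have hKF : (K ∩ F).Nonempty := by
      obtain ⟨q, hq⟩ := exists_rat_lt (f v)
      obtain ⟨x, hxK, hxF, -⟩ := h q ⟨v, hvK, hq⟩
      exact ⟨x, hxK, hxF⟩
    obtain ⟨u, hu, hmax⟩ := (hK.inter_right hF).exists_isMaxOn hKF hf.continuousOn
    refine ⟨u, hu, le_antisymm (le_csSup hbdd (Set.mem_image_of_mem f hu.1)) ?_⟩
    rw [hv]
    by_contra! hlt
    obtain ⟨q, huq, hqv⟩ := exists_rat_btwn hlt
    obtain ⟨x, hxK, hxF, hx⟩ := h q ⟨v, hvK, hqv⟩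
    exact (huq.trans_le hx).not_ge (hmax ⟨hxK, hxF⟩)


/-- Refinement step in the semigroup selection argument: if `S` is a Borel measurable
set-valued map with nonempty compact values between Polish spaces and `I : Ω → ℝ` is
continuous, then the refined map `S^I(a) = {u ∈ S(a) : I(u) = max_{v ∈ S(a)} I(v)}`
again has nonempty compact values and is Borel measurable. -/
theorem refined_setValued_map_measurable
    {H : Type*} [TopologicalSpace H] [PolishSpace H]
    [MeasurableSpace H] [BorelSpace H]
    {Ω : Type*} [TopologicalSpace Ω] [PolishSpace Ω]
    (S : H → Set Ω)
    (hne : ∀ a : H, (S a).Nonempty)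
    (hcpt : ∀ a : H, IsCompact (S a))
    (hmeas : ∀ U : Set Ω, IsOpen U → MeasurableSet {a : H | (S a ∩ U).Nonempty})
    (I : Ω → ℝ) (hI : Continuous I)
    (SI : H → Set Ω)
    (hSI : ∀ a : H, SI a = {u ∈ S a | I u = sSup (I '' S a)}) :
    (∀ a : H, (SI a).Nonempty) ∧ (∀ a : H, IsCompact (SI a)) ∧
      ∀ U : Set Ω, IsOpen U → MeasurableSet {a : H | (SI a ∩ U).Nonempty} := by
  refine ⟨fun a => ?_, fun a => ?_, fun U hU => ?_⟩
  · obtain ⟨v, hvS, hv⟩ := (hcpt a).exists_sSup_image_eq (hne a) hI.continuousOn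
    rw [hSI]
    exact ⟨v, hvS, hv.symm⟩
  · rw [hSI]
    exact (hcpt a).inter_right (isClosed_eq hI continuous_const)
  · let _ := TopologicalSpace.metrizableSpaceMetric Ω
    obtain ⟨F, hF, -, hFU, -⟩ := hU.exists_iUnion_isClosed
    have key : {a | (SI a ∩ U).Nonempty} = ⋃ n, ⋂ q : ℚ,
        ({a | (S a ∩ {x | (q : ℝ) < I x}).Nonempty}ᶜ ∪
          {a | (S a ∩ (F n ∩ {x | (q : ℝ) ≤ I x})).Nonempty}) := by
      ext a
      have hiff := fun n =>
        (hcpt a).exists_isMaxOn_mem_iff_forall_rat (hne a) (hF n) hI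
      simp only [Set.mem_iUnion, Set.mem_iInter, Set.mem_union, Set.mem_compl_iff,
        Set.mem_ofPred_eq, ← imp_iff_not_or, ← hiff, ← hFU, hSI]
      constructor
      · rintro ⟨u, ⟨huS, hu⟩, huF⟩
        obtain ⟨n, hn⟩ := Set.mem_iUnion.1 huF
        exact ⟨n, u, ⟨huS, hn⟩, hu⟩
      · rintro ⟨n, u, ⟨huS, hn⟩, hu⟩
        exact ⟨u, ⟨huS, hu⟩, Set.mem_iUnion.2 ⟨n, hn⟩⟩
    rw [key]
    exact MeasurableSet.iUnion fun n => MeasurableSet.iInter fun q =>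
      (hmeas _ (isOpen_lt continuous_const hI)).compl.union
        (measurableSet_inter_nonempty_of_isClosed hcpt hmeas
          ((hF n).inter (isClosed_le continuous_const hI)))
end

section
/- Let H be a Polish space with its Borel σ-algebra, let Ω = C([0, ∞); H) with the compact-open topology, and let S : H → Set(Ω) be a set-valued map satisfying: (i) S(a) is a nonempty compact subset of Ω for every a; (ii) S is Borel measurable; (iii) every u ∈ S(a) satisfies u(0) = a; (iv) for every u ∈ S(a) and t ≥ 0 the shifted path s ↦ u(t+s) belongs to S(u(t)); (v) for every u ∈ S(a), t ≥ 0, and v ∈ S(u(t)), the concatenation w (with w(s) = u(s) for s ≤ t and w(s) = v(s−t) for s > t) belongs to S(a). Suppose additionally that for some a₀ ∈ H the set S(a₀) contains at least two distinct paths. Then there exist at least two distinct Borel measurable maps U₁, U₂ : H → Ω, each satisfying U_i(a) ∈ S(a) for all a ∈ H and the semigroup property U_i(a)(t+s) = U_i(U_i(a)(t))(s) for all s, t ≥ 0, with U₁(a₀) ≠ U₂(a₀). -/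
open scoped NNReal
open Set Filter Topology MeasureTheory

namespace PathSelection

section Paths

variable {H : Type*} [TopologicalSpace H]

/-- The path `s ↦ u (t + s)`. -/
def shift (t : ℝ≥0) (u : C(ℝ≥0, H)) : C(ℝ≥0, H) :=
  ⟨fun s => u (t + s), by fun_prop⟩

@[simp]
lemma shift_apply (t s : ℝ≥0) (u : C(ℝ≥0, H)) : shift t u s = u (t + s) := rfl

/-- Following `u` up to time `t` and then `v` is continuous if `v` starts at `u t`. -/
lemma exists_concat (u v : C(ℝ≥0, H)) (t : ℝ≥0) (h : v 0 = u t) :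
    ∃ w : C(ℝ≥0, H), (∀ s ≤ t, w s = u s) ∧ shift t w = v := by
  have hcont : Continuous fun s : ℝ≥0 => if s ≤ t then u s else v (s - t) := by
    refine Continuous.if_le (by fun_prop) (by fun_prop) continuous_id continuous_const ?_
    rintro s rfl
    simp [h]
  refine ⟨⟨_, hcont⟩, fun s hs => by simp [hs], ?_⟩
  ext s
  rcases eq_or_ne s 0 with rfl | hs
  · simp [h]
  · simp [hs]

/-- A set-valued map into path space with compact nonempty values which is closed under shifts
and concatenations and whose hitting sets of closed sets are measurable. -/
structure IsSemiflow [MeasurableSpace H] (S : H → Set C(ℝ≥0, H)) : Prop where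
  nonempty : ∀ a, (S a).Nonempty
  isCompact : ∀ a, IsCompact (S a)
  measurable : ∀ F : Set C(ℝ≥0, H), IsClosed F → MeasurableSet {a | (S a ∩ F).Nonempty}
  start : ∀ a, ∀ u ∈ S a, u 0 = a
  shift_mem : ∀ a, ∀ u ∈ S a, ∀ t, shift t u ∈ S (u t)
  concat_mem : ∀ a, ∀ u ∈ S a, ∀ t, ∀ w : C(ℝ≥0, H),
    (∀ s ≤ t, w s = u s) → shift t w ∈ S (u t) → w ∈ S a

/-- A functional on paths such that comparing two paths that agree up to time `t` amounts to
comparing their shifts by `t`. -/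
def ShiftMonotone (J : C(ℝ≥0, H) → ℝ) : Prop :=
  ∀ (t : ℝ≥0) (u w : C(ℝ≥0, H)), (∀ s ≤ t, w s = u s) →
    (J w ≤ J u ↔ J (shift t w) ≤ J (shift t u))

lemma ShiftMonotone.neg {J : C(ℝ≥0, H) → ℝ} (hJ : ShiftMonotone J) :
    ShiftMonotone fun u => -J u := fun t u w h => by
  simpa using hJ t w u fun s hs => (h s hs).symm

/-- The maximizers of `J` on each value of `S`. -/
def maximizers (S : H → Set C(ℝ≥0, H)) (J : C(ℝ≥0, H) → ℝ) (a : H) : Set C(ℝ≥0, H) :=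
  {u ∈ S a | ∀ v ∈ S a, J v ≤ J u}

lemma nonempty_maximizers_inter_iff {S : H → Set C(ℝ≥0, H)} {J : C(ℝ≥0, H) → ℝ} {a : H}
    (hne : (S a).Nonempty) (hS : IsCompact (S a)) (hJ : Continuous J) {F : Set C(ℝ≥0, H)}
    (hF : IsClosed F) :
    (maximizers S J a ∩ F).Nonempty ↔ ∀ q : ℚ, (S a ∩ {u | q < J u}).Nonempty →
      (S a ∩ (F ∩ {u | q ≤ J u})).Nonempty := by
  constructor
  · rintro ⟨u, ⟨hu, hmax⟩, huF⟩ q ⟨v, hv, hqv⟩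
    exact ⟨u, hu, huF, hqv.le.trans (hmax v hv)⟩
  · intro h
    obtain ⟨m, hm, hmmax⟩ := hS.exists_isMaxOn hne hJ.continuousOn
    have hcF := hS.inter_right hF
    have hFne : (S a ∩ F).Nonempty := by
      obtain ⟨q, hq⟩ := exists_rat_lt (J m)
      obtain ⟨u, hu, huF, -⟩ := h q ⟨m, hm, hq⟩
      exact ⟨u, hu, huF⟩
    obtain ⟨u, ⟨hu, huF⟩, humax⟩ := hcF.exists_isMaxOn hFne hJ.continuousOn
    refine ⟨u, ⟨hu, fun v hv => ?_⟩, huF⟩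
    by_contra! hlt
    obtain ⟨q, hq1, hq2⟩ := exists_rat_btwn hlt
    obtain ⟨x, hx, hxF, hqx⟩ := h q ⟨v, hv, hq2⟩
    exact (hq1.trans_le (hqx.trans (humax ⟨hx, hxF⟩))).false

variable [MeasurableSpace H]

theorem IsSemiflow.maximizers {S : H → Set C(ℝ≥0, H)} (hS : IsSemiflow S)
    {J : C(ℝ≥0, H) → ℝ} (hJc : Continuous J) (hJ : ShiftMonotone J)
    (hopen : ∀ U : Set C(ℝ≥0, H), IsOpen U → MeasurableSet {a | (S a ∩ U).Nonempty}) :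
    IsSemiflow (maximizers S J) where
  nonempty a := by
    obtain ⟨m, hm, hmax⟩ := (hS.isCompact a).exists_isMaxOn (hS.nonempty a) hJc.continuousOn
    exact ⟨m, hm, hmax⟩
  isCompact a := by
    have : PathSelection.maximizers S J a = S a ∩ ⋂ v ∈ S a, {u | J v ≤ J u} := by
      ext u
      simp [PathSelection.maximizers]
    rw [this]
    exact (hS.isCompact a).inter_right
      (isClosed_biInter fun v _ => isClosed_le continuous_const hJc)
  measurable F hF := by
    simp_rw [nonempty_maximizers_inter_iff (hS.nonempty _) (hS.isCompact _) hJc hF, ofPred_forall]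
    exact .iInter fun q => .imp (hopen _ (isOpen_lt continuous_const hJc))
      (hS.measurable _ (hF.inter (isClosed_le continuous_const hJc)))
  start a u hu := hS.start a u hu.1
  shift_mem a u hu t := by
    refine ⟨hS.shift_mem a u hu.1 t, fun v hv => ?_⟩
    obtain ⟨w, hwu, rfl⟩ := exists_concat u v t (hS.start _ v hv)
    exact (hJ t u w hwu).1 (hu.2 w (hS.concat_mem a u hu.1 t w hwu hv))
  concat_mem a u hu t w hwu hw := by
    refine ⟨hS.concat_mem a u hu.1 t w hwu hw.1, fun v hv => (hu.2 v hv).trans ?_⟩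
    exact (hJ t w u fun s hs => (hwu s hs).symm).2 (hw.2 _ (hS.shift_mem a u hu.1 t))

/-- Open sets are countable unions of closed sets in a metrizable space. -/
lemma IsSemiflow.measurable_open [TopologicalSpace.MetrizableSpace C(ℝ≥0, H)]
    {S : H → Set C(ℝ≥0, H)} (hS : IsSemiflow S) (U : Set C(ℝ≥0, H)) (hU : IsOpen U) :
    MeasurableSet {a | (S a ∩ U).Nonempty} := by
  let _ := TopologicalSpace.metrizableSpaceMetric C(ℝ≥0, H)
  obtain ⟨F, hF, -, rfl, -⟩ := hU.exists_iUnion_isClosed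
  simp_rw [inter_iUnion, nonempty_iUnion, ofPred_exists]
  exact .iUnion fun n => hS.measurable _ (hF n)

/-- For compact values, measurability of the hitting sets of open sets passes to closed sets. -/
lemma measurableSet_inter_closed [TopologicalSpace.MetrizableSpace C(ℝ≥0, H)]
    {S : H → Set C(ℝ≥0, H)} (hS : ∀ a, IsCompact (S a))
    (hopen : ∀ U : Set C(ℝ≥0, H), IsOpen U → MeasurableSet {a | (S a ∩ U).Nonempty})
    {F : Set C(ℝ≥0, H)} (hF : IsClosed F) : MeasurableSet {a | (S a ∩ F).Nonempty} := by
  let _ := TopologicalSpace.metrizableSpaceMetric C(ℝ≥0, H)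
  have key : ∀ a, (S a ∩ F).Nonempty ↔
      ∀ n : ℕ, (S a ∩ Metric.thickening (1 / ((n : ℝ) + 1)) F).Nonempty := by
    refine fun a => ⟨fun h n => h.mono <| inter_subset_inter_right _ <|
      Metric.self_subset_thickening Nat.one_div_pos_of_nat F, fun h => ?_⟩
    by_contra hdisj
    rw [not_nonempty_iff_eq_empty, ← disjoint_iff_inter_eq_empty] at hdisj
    obtain ⟨δ, hδ, hd⟩ := hdisj.exists_thickenings (hS a) hF
    obtain ⟨n, hn⟩ := exists_nat_one_div_lt hδ
    obtain ⟨u, hu, huF⟩ := h n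
    exact disjoint_left.1 hd (Metric.self_subset_thickening hδ _ hu)
      (Metric.thickening_mono hn.le _ huF)
  simp_rw [key, ofPred_forall]
  exact .iInter fun n => hopen _ Metric.isOpen_thickening

/-- Successive refinement of `S` by a sequence of functionals. -/
def iteratedMaximizers (S : H → Set C(ℝ≥0, H)) (J : ℕ → C(ℝ≥0, H) → ℝ) : ℕ → H → Set C(ℝ≥0, H)
  | 0 => S
  | n + 1 => maximizers (iteratedMaximizers S J n) (J n)

variable [TopologicalSpace.MetrizableSpace C(ℝ≥0, H)]

/-- Refining by a separating sequence of functionals leaves exactly one path in each value, and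
this defines a measurable semigroup selection. -/
theorem IsSemiflow.exists_selection [T2Space H] [MeasurableSpace C(ℝ≥0, H)] [BorelSpace C(ℝ≥0, H)]
    {S : H → Set C(ℝ≥0, H)} (hS : IsSemiflow S) (J : ℕ → C(ℝ≥0, H) → ℝ)
    (hJc : ∀ n, Continuous (J n)) (hJ : ∀ n, ShiftMonotone (J n))
    (hsep : ∀ u v, (∀ n, J n u = J n v) → u = v) :
    ∃ U : H → C(ℝ≥0, H), Measurable U ∧ (∀ a, U a ∈ S a) ∧
      (∀ (a : H) (t s : ℝ≥0), U a (t + s) = U (U a t) s) ∧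
      ∀ a, ∀ v ∈ S a, J 0 v ≤ J 0 (U a) := by
  set T := iteratedMaximizers S J
  have hT : ∀ n, IsSemiflow (T n) := fun n => by
    induction n with
    | zero => exact hS
    | succ n ih => exact ih.maximizers (hJc n) (hJ n) ih.measurable_open
  have hanti : ∀ n a, T (n + 1) a ⊆ T n a := fun n a u hu => hu.1
  have hinter : ∀ a (F : Set C(ℝ≥0, H)), IsClosed F → (∀ n, (T n a ∩ F).Nonempty) →
      (⋂ n, (T n a ∩ F)).Nonempty := fun a F hF hne =>
    IsCompact.nonempty_iInter_of_sequence_nonempty_isCompact_isClosed _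
      (fun n => inter_subset_inter_left _ (hanti n a)) hne (((hT 0).isCompact a).inter_right hF)
      fun n => ((hT n).isCompact a).isClosed.inter hF
  have huniq : ∀ a u v, (∀ n, u ∈ T n a) → (∀ n, v ∈ T n a) → u = v := fun a u v hu hv =>
    hsep u v fun n => le_antisymm ((hv (n + 1)).2 u (hu n)) ((hu (n + 1)).2 v (hv n))
  have hex : ∀ a, ∃ u, ∀ n, u ∈ T n a := fun a => by
    simpa [Set.Nonempty] using hinter a univ isClosed_univ (by simpa using fun n => (hT n).nonempty a)
  choose U hU using hex
  refine ⟨U, measurable_of_isClosed fun F hF => ?_, fun a => hU a 0, fun a t s => ?_,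
    fun a v hv => (hU a 1).2 v hv⟩
  · have : U ⁻¹' F = ⋂ n, {a | (T n a ∩ F).Nonempty} := by
      ext a
      simp only [mem_preimage, mem_iInter, mem_ofPred_eq]
      refine ⟨fun h n => ⟨U a, hU a n, h⟩, fun h => ?_⟩
      obtain ⟨u, hu⟩ := hinter a F hF h
      rw [mem_iInter] at hu
      exact huniq a u (U a) (fun n => (hu n).1) (hU a) ▸ (hu 0).2
    rw [this]
    exact .iInter fun n => (hT n).measurable F hF
  · rw [← shift_apply, huniq (U a t) (shift t (U a)) (U (U a t))
      (fun n => (hT n).shift_mem a _ (hU a n) t) (hU _)]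

/-- Given a separating sequence of functionals, nonuniqueness at a point yields two different
semigroup selections. -/
theorem IsSemiflow.exists_two_selections [T2Space H] [MeasurableSpace C(ℝ≥0, H)]
    [BorelSpace C(ℝ≥0, H)] {S : H → Set C(ℝ≥0, H)} (hS : IsSemiflow S)
    (J : ℕ → C(ℝ≥0, H) → ℝ) (hJc : ∀ n, Continuous (J n)) (hJ : ∀ n, ShiftMonotone (J n))
    (hsep : ∀ u v, (∀ n, J n u = J n v) → u = v)
    {a₀ : H} (hnonuniq : (S a₀).Nontrivial) :
    ∃ U₁ U₂ : H → C(ℝ≥0, H),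
      Measurable U₁ ∧ Measurable U₂ ∧
      (∀ a : H, U₁ a ∈ S a) ∧ (∀ a : H, U₂ a ∈ S a) ∧
      (∀ (a : H) (t s : ℝ≥0), U₁ a (t + s) = U₁ (U₁ a t) s) ∧
      (∀ (a : H) (t s : ℝ≥0), U₂ a (t + s) = U₂ (U₂ a t) s) ∧
      U₁ a₀ ≠ U₂ a₀ := by
  obtain ⟨u₁, h₁, u₂, h₂, hne⟩ := hnonuniq
  obtain ⟨m, hm⟩ : ∃ m, J m u₁ ≠ J m u₂ := by
    by_contra! h
    exact hne (hsep _ _ h)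
  have main : ∀ J₀ : C(ℝ≥0, H) → ℝ, Continuous J₀ → ShiftMonotone J₀ →
      ∃ U : H → C(ℝ≥0, H), Measurable U ∧ (∀ a, U a ∈ S a) ∧
      (∀ (a : H) (t s : ℝ≥0), U a (t + s) = U (U a t) s) ∧
      ∀ a, ∀ v ∈ S a, J₀ v ≤ J₀ (U a) := fun J₀ hc hs =>
    hS.exists_selection (fun n => Nat.casesOn n J₀ J) (fun n => by cases n <;> simp [hc, hJc])
      (fun n => by cases n <;> simp [hs, hJ]) fun u v h => hsep u v fun n => h (n + 1)
  obtain ⟨U₁, hm₁, hU₁, hs₁, hmax⟩ := main (J m) (hJc m) (hJ m)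
  obtain ⟨U₂, hm₂, hU₂, hs₂, hmin⟩ := main _ (hJc m).neg (hJ m).neg
  refine ⟨U₁, U₂, hm₁, hm₂, hU₁, hU₂, hs₁, hs₂, fun heq => hm ?_⟩
  have hle : ∀ v ∈ S a₀, J m v = J m (U₂ a₀) := fun v hv =>
    le_antisymm (heq ▸ hmax a₀ v hv) (neg_le_neg_iff.1 (hmin a₀ v hv))
  rw [hle u₁ h₁, hle u₂ h₂]

end Paths

section Laplace

/-- Lebesgue measure on the half-line. -/
noncomputable def halfLine : Measure ℝ≥0 :=
  (volume.restrict (Ioi (0 : ℝ))).map Real.toNNReal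

lemma integral_halfLine {F : ℝ≥0 → ℝ} (hF : Continuous F) :
    ∫ s, F s ∂halfLine = ∫ s : ℝ in Ioi 0, F s.toNNReal :=
  integral_map (by fun_prop) hF.aestronglyMeasurable

instance : halfLine.IsOpenPosMeasure where
  open_pos U hU hne := by
    rw [halfLine, Measure.map_apply (by fun_prop) hU.measurableSet,
      Measure.restrict_apply (hU.measurableSet.preimage (by fun_prop))]
    refine IsOpen.measure_ne_zero _
      ((hU.preimage continuous_real_toNNReal).inter isOpen_Ioi) ?_
    have hd : Dense (Ioi (0 : ℝ≥0)) := by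
      rw [dense_iff_closure_eq, closure_Ioi]
      exact Ici_bot
    obtain ⟨x, hxU, hx⟩ := hd.inter_open_nonempty U hU hne
    exact ⟨x, by simpa using hxU, by simpa using hx⟩

lemma integral_halfLine_add {F : ℝ≥0 → ℝ} (hF : Continuous F) (t : ℝ≥0)
    (h0 : ∀ s ≤ t, F s = 0) :
    ∫ s, F (t + s) ∂halfLine = ∫ s, F s ∂halfLine := by
  rw [integral_halfLine hF, integral_halfLine (by fun_prop), ← integral_indicator measurableSet_Ioi,
    ← integral_indicator measurableSet_Ioi,
    ← integral_add_left_eq_self ((Ioi (0 : ℝ)).indicator fun s => F s.toNNReal) (t : ℝ)]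
  congr 1 with s
  rcases lt_or_ge 0 s with hs | hs
  · have hts : (0 : ℝ) < t + s := by positivity
    rw [indicator_of_mem (mem_Ioi.2 hs), indicator_of_mem (mem_Ioi.2 hts),
      Real.toNNReal_add t.coe_nonneg hs.le, Real.toNNReal_coe]
  · rw [indicator_of_notMem (by simpa using hs)]
    refine (indicator_apply_eq_zero (f := fun s : ℝ => F s.toNNReal).2 fun _ => h0 _ ?_).symm
    rw [Real.toNNReal_le_iff_le_coe]
    linarith

lemma integrable_exp_halfLine (k : ℕ) :
    Integrable (fun s : ℝ≥0 => Real.exp (-((k : ℝ) + 1) * s)) halfLine := by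
  rw [halfLine, integrable_map_measure (by fun_prop) (by fun_prop)]
  refine (integrableOn_exp_mul_Ioi (a := -((k : ℝ) + 1)) (by linarith [k.cast_nonneg (α := ℝ)])
    0).congr_fun (fun s hs => ?_) measurableSet_Ioi
  simp [Real.coe_toNNReal s (le_of_lt hs)]

lemma integrable_exp_mul (k : ℕ) {f : ℝ≥0 → ℝ} (hf : Continuous f) {C : ℝ} (hC : ∀ s, |f s| ≤ C) :
    Integrable (fun s : ℝ≥0 => Real.exp (-((k : ℝ) + 1) * s) * f s) halfLine :=
  (integrable_exp_halfLine k).mul_bdd hf.aestronglyMeasurable (.of_forall hC)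

/-- The function `s ↦ exp (-s)` on the half-line. -/
noncomputable def expNeg : BoundedContinuousFunction ℝ≥0 ℝ :=
  .ofNormedAddCommGroup (fun s => Real.exp (-s)) (by fun_prop) 1 fun s => by simp

/-- A bounded continuous nonnegative function on the half-line is determined by its Laplace
transform at the positive integers. -/
theorem eq_of_laplace_eq {f g : ℝ≥0 → ℝ} (hf : Continuous f) (hg : Continuous g) {C : ℝ}
    (hfC : ∀ s, f s ≤ C) (hgC : ∀ s, g s ≤ C) (hf0 : ∀ s, 0 ≤ f s) (hg0 : ∀ s, 0 ≤ g s)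
    (h : ∀ k : ℕ, ∫ s, Real.exp (-((k : ℝ) + 1) * s) * f s ∂halfLine =
      ∫ s, Real.exp (-((k : ℝ) + 1) * s) * g s ∂halfLine) : f = g := by
  have hfi := fun k => integrable_exp_mul k hf fun s => (abs_of_nonneg (hf0 s)).trans_le (hfC s)
  have hgi := fun k => integrable_exp_mul k hg fun s => (abs_of_nonneg (hg0 s)).trans_le (hgC s)
  let d (f : ℝ≥0 → ℝ) (s : ℝ≥0) : ENNReal := ENNReal.ofReal (Real.exp (-s) * f s)
  have hd : ∀ {f : ℝ≥0 → ℝ}, Continuous f → Continuous (d f) := fun hf =>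
    ENNReal.continuous_ofReal.comp (by fun_prop)
  have hlt : ∀ {f : ℝ≥0 → ℝ},
      (∀ k : ℕ, Integrable (fun s : ℝ≥0 => Real.exp (-((k : ℝ) + 1) * s) * f s) halfLine) →
      ∫⁻ s, d f s ∂halfLine ≠ ⊤ := fun hi => by
    simpa [d] using (hi 0).lintegral_lt_top.ne
  have hpow : ∀ {f : ℝ≥0 → ℝ}, Continuous f → (∀ s, 0 ≤ f s) → ∀ p : BoundedContinuousFunction ℝ≥0 ℝ,
      ∫ s, p s ∂halfLine.withDensity (d f) = ∫ s, Real.exp (-s) * f s * p s ∂halfLine :=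
    fun {f} hf hf0 p => by
      rw [integral_withDensity_eq_integral_toReal_smul (by fun_prop) (by simp [d])]
      congr 1 with s
      rw [ENNReal.toReal_ofReal (mul_nonneg (Real.exp_nonneg _) (hf0 s)), smul_eq_mul]
  have := isFiniteMeasure_withDensity (hlt hfi)
  have := isFiniteMeasure_withDensity (hlt hgi)
  have hmom : ∀ {f : ℝ≥0 → ℝ}, Continuous f → (∀ s, 0 ≤ f s) → ∀ k : ℕ,
      ∫ s, (expNeg ^ k) s ∂halfLine.withDensity (d f) =
        ∫ s, Real.exp (-((k : ℝ) + 1) * s) * f s ∂halfLine := fun {f} hf hf0 k => by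
    rw [hpow hf hf0]
    congr 1 with s
    have : Real.exp (-((k : ℝ) + 1) * s) = Real.exp (-s) * (Real.exp (-s)) ^ k := by
      rw [← Real.exp_nat_mul, ← Real.exp_add]
      ring_nf
    rw [this]
    change _ * _ * (Real.exp (-s)) ^ k = _
    ring
  let A : StarSubalgebra ℝ (BoundedContinuousFunction ℝ≥0 ℝ) :=
    { Algebra.adjoin ℝ {expNeg} with star_mem' := fun {a} ha => (show star a = a from rfl) ▸ ha }
  have hAsep : (A.map (BoundedContinuousFunction.toContinuousMapStarₐ ℝ)).SeparatesPoints := by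
    intro x y hxy
    refine ⟨expNeg, ⟨expNeg.toContinuousMap, ⟨expNeg, Algebra.subset_adjoin rfl, rfl⟩, rfl⟩, ?_⟩
    simpa [expNeg] using hxy
  have hμ : halfLine.withDensity (d f) = halfLine.withDensity (d g) := by
    refine ext_of_forall_mem_subalgebra_integral_eq_of_polish hAsep fun p hp => ?_
    replace hp : p ∈ Submodule.span ℝ (Set.range fun k : ℕ => expNeg ^ k) := by
      rw [← Submonoid.coe_powers, Submonoid.powers_eq_closure, ← Algebra.adjoin_eq_span]
      exact hp
    induction hp using Submodule.span_induction with
    | mem p hp =>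
      obtain ⟨k, rfl⟩ := hp
      simp only [hmom hf hf0, hmom hg hg0, h]
    | zero => simp
    | add p q _ _ hp hq =>
      simp only [BoundedContinuousFunction.coe_add, Pi.add_apply]
      rw [integral_add (p.integrable _) (q.integrable _),
        integral_add (p.integrable _) (q.integrable _), hp, hq]
    | smul c p _ hp =>
      simp only [BoundedContinuousFunction.coe_smul]
      rw [integral_smul, integral_smul, hp]
  rw [withDensity_eq_iff (hd hf).aemeasurable (hd hg).aemeasurable (hlt hfi),
    Continuous.ae_eq_iff_eq _ (hd hf) (hd hg)] at hμ
  ext s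
  have hs := congrFun hμ s
  rw [ENNReal.ofReal_eq_ofReal_iff (mul_nonneg (Real.exp_nonneg _) (hf0 s))
    (mul_nonneg (Real.exp_nonneg _) (hg0 s))] at hs
  exact mul_left_cancel₀ (Real.exp_ne_zero _) hs

variable {H : Type*} [TopologicalSpace H]

/-- The Laplace transform at `k + 1` of an observable along a path. -/
noncomputable def laplace (k : ℕ) (φ : H → ℝ) (u : C(ℝ≥0, H)) : ℝ :=
  ∫ s, Real.exp (-((k : ℝ) + 1) * s) * φ (u s) ∂halfLine

variable {φ : H → ℝ} {C : ℝ}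

lemma continuous_laplace [FirstCountableTopology C(ℝ≥0, H)] (k : ℕ) (hφ : Continuous φ)
    (hC : ∀ x, |φ x| ≤ C) : Continuous (laplace k φ) := by
  refine continuous_of_dominated (bound := fun s => Real.exp (-((k : ℝ) + 1) * s) * C)
    (fun u => (by fun_prop : Continuous _).aestronglyMeasurable)
    (fun u => .of_forall fun s => ?_) ((integrable_exp_halfLine k).mul_const C)
    (.of_forall fun s => by fun_prop)
  rw [norm_mul, Real.norm_of_nonneg (Real.exp_nonneg _)]
  exact mul_le_mul_of_nonneg_left (hC _) (Real.exp_nonneg _)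

lemma shiftMonotone_laplace (k : ℕ) (hφ : Continuous φ) (hC : ∀ x, |φ x| ≤ C) :
    ShiftMonotone (laplace k φ) := by
  intro t u w h
  have hi : ∀ u : C(ℝ≥0, H), Integrable
      (fun s : ℝ≥0 => Real.exp (-((k : ℝ) + 1) * s) * φ (u s)) halfLine := fun u =>
    integrable_exp_mul k (by fun_prop) fun s => hC (u s)
  have key : laplace k φ w - laplace k φ u = Real.exp (-((k : ℝ) + 1) * t) *
      (laplace k φ (shift t w) - laplace k φ (shift t u)) := by
    simp only [laplace]
    rw [← integral_sub (hi w) (hi u), ← integral_sub (hi _) (hi _),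
      ← integral_halfLine_add (by fun_prop) t fun s hs => by simp [h s hs], ← integral_const_mul]
    congr 1 with s
    rw [NNReal.coe_add, mul_add, Real.exp_add, shift_apply, shift_apply]
    ring
  have hpos := Real.exp_pos (-((k : ℝ) + 1) * t)
  rw [← sub_nonpos, key, ← sub_nonpos (a := laplace k φ (shift t w))]
  exact ⟨fun h => nonpos_of_mul_nonpos_right h hpos, mul_nonpos_of_nonneg_of_nonpos hpos.le⟩

/-- A Polish space carries a sequence of continuous functions into `[0, 1]` separating points. -/
lemma exists_separating_sequence (H : Type*) [TopologicalSpace H] [PolishSpace H] :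
    ∃ φ : ℕ → H → ℝ, (∀ m, Continuous (φ m)) ∧ (∀ m x, 0 ≤ φ m x) ∧ (∀ m x, φ m x ≤ 1) ∧
      ∀ x y, (∀ m, φ m x = φ m y) → x = y := by
  let _ := TopologicalSpace.metrizableSpaceMetric H
  rcases isEmpty_or_nonempty H with hH | hH
  · exact ⟨fun _ _ => 0, fun _ => continuous_const, by simp, by simp, fun x => hH.elim x⟩
  refine ⟨fun m x => min 1 (dist x (TopologicalSpace.denseSeq H m)), fun m => by fun_prop,
    fun m x => by positivity, fun m x => min_le_left _ _, fun x y h => ?_⟩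
  refine eq_of_forall_dist_le fun ε hε => ?_
  obtain ⟨m, hm⟩ := (TopologicalSpace.denseRange_denseSeq H).exists_dist_lt x
    (lt_min one_pos (half_pos hε))
  have hx := hm.trans_le (min_le_right _ _)
  have hy : dist y (TopologicalSpace.denseSeq H m) < ε / 2 := by
    have : min 1 (dist x _) = min 1 (dist y _) := h m
    rw [min_eq_right (hm.trans_le (min_le_left _ _)).le] at this
    rcases min_choice 1 (dist y (TopologicalSpace.denseSeq H m)) with h1 | h1
    · linarith [min_le_left 1 (ε / 2)]
    · linarith
  linarith [dist_triangle_right x y (TopologicalSpace.denseSeq H m)]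

end Laplace

end PathSelection

/-- If a set-valued map `S` as in the measurable semiflow selection theorem is non-unique
at some point `a₀` (i.e. `S a₀` contains two distinct paths), then there exist at least
two distinct Borel measurable semigroup selections of `S`, differing at `a₀`. -/
theorem exists_two_measurable_semiflow_selections
    {H : Type*} [TopologicalSpace H] [PolishSpace H]
    [MeasurableSpace H] [BorelSpace H]
    [MeasurableSpace C(ℝ≥0, H)] [BorelSpace C(ℝ≥0, H)]
    (S : H → Set C(ℝ≥0, H))
    (hne : ∀ a : H, (S a).Nonempty)
    (hcpt : ∀ a : H, IsCompact (S a))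
    (hmeas : ∀ U : Set C(ℝ≥0, H), IsOpen U → MeasurableSet {a : H | (S a ∩ U).Nonempty})
    (hstart : ∀ a : H, ∀ u ∈ S a, u 0 = a)
    (hshift : ∀ a : H, ∀ u ∈ S a, ∀ t : ℝ≥0, ∀ w : C(ℝ≥0, H),
      (∀ s : ℝ≥0, w s = u (t + s)) → w ∈ S (u t))
    (hconcat : ∀ a : H, ∀ u ∈ S a, ∀ t : ℝ≥0, ∀ v ∈ S (u t), ∀ w : C(ℝ≥0, H),
      (∀ s : ℝ≥0, s ≤ t → w s = u s) → (∀ s : ℝ≥0, t < s → w s = v (s - t)) →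
      w ∈ S a)
    (a₀ : H) (hnonuniq : ∃ u₁ ∈ S a₀, ∃ u₂ ∈ S a₀, u₁ ≠ u₂) :
    ∃ U₁ U₂ : H → C(ℝ≥0, H),
      Measurable U₁ ∧ Measurable U₂ ∧
      (∀ a : H, U₁ a ∈ S a) ∧ (∀ a : H, U₂ a ∈ S a) ∧
      (∀ (a : H) (t s : ℝ≥0), U₁ a (t + s) = U₁ (U₁ a t) s) ∧
      (∀ (a : H) (t s : ℝ≥0), U₂ a (t + s) = U₂ (U₂ a t) s) ∧
      U₁ a₀ ≠ U₂ a₀ := by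
  have : TopologicalSpace.MetrizableSpace C(ℝ≥0, H) := by
    let _ := TopologicalSpace.metrizableSpaceMetric H
    infer_instance
  have hS : PathSelection.IsSemiflow S :=
    { nonempty := hne
      isCompact := hcpt
      measurable := fun F hF => PathSelection.measurableSet_inter_closed hcpt hmeas hF
      start := hstart
      shift_mem := fun a u hu t => hshift a u hu t _ fun s => rfl
      concat_mem := fun a u hu t w hwu hw => hconcat a u hu t _ hw w hwu fun s hs => by
        rw [PathSelection.shift_apply, add_tsub_cancel_of_le hs.le] }
  obtain ⟨φ, hφ, hφ0, hφ1, hsep⟩ := PathSelection.exists_separating_sequence H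
  have hφabs : ∀ m x, |φ m x| ≤ 1 := fun m x => (abs_of_nonneg (hφ0 m x)).trans_le (hφ1 m x)
  refine hS.exists_two_selections
    (fun n => PathSelection.laplace n.unpair.1 (φ n.unpair.2))
    (fun n => PathSelection.continuous_laplace _ (hφ _) (hφabs _))
    (fun n => PathSelection.shiftMonotone_laplace _ (hφ _) (hφabs _)) (fun u v h => ?_) hnonuniq
  ext s
  refine hsep _ _ fun m => congrFun (PathSelection.eq_of_laplace_eq (f := fun s => φ m (u s))
    (g := fun s => φ m (v s)) ((hφ m).comp u.continuous) ((hφ m).comp v.continuous)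
    (fun s => hφ1 m _) (fun s => hφ1 m _) (fun s => hφ0 m _) (fun s => hφ0 m _) fun k => ?_) s
  simpa [PathSelection.laplace] using h (Nat.pair k m)
end
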